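/- Let H be a complex Hilbert space and 𝒮 a subset of the bounded operators on H that is closed under taking (Hilbert-space) adjoints. Let T be a densely defined closable unbounded operator on H with domain D such that T commutes with 𝒮, i.e. for every S ∈ 𝒮 one has S(D) ⊆ D and T(Sv) = S(Tv) for all v ∈ D. Then the closure T̄ of T commutes with the double commutant 𝒮'': for every bounded operator R ∈ 𝒮'' and every v in the domain of T̄, one has Rv ∈ dom(T̄) and T̄(Rv) = R(T̄v). -/

import Mathlib

open ContinuousLinearMap

/-- The orthogonal projection onto a closed subspace that is invariant under both `A` and its
adjoint commutes with `A`. -/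
theorem Submodule.starProjection_apply_comm_of_invariant {K : Type*} [NormedAddCommGroup K]
    [InnerProductSpace ℂ K] (G : Submodule ℂ K) [G.HasOrthogonalProjection]
    (A B : K →L[ℂ] K) (hAB : ∀ x y, inner ℂ x (A y) = inner ℂ (B x) y)
    (hA : ∀ g ∈ G, A g ∈ G) (hB : ∀ g ∈ G, B g ∈ G) (x : K) :
    G.starProjection (A x) = A (G.starProjection x) := by
  refine Submodule.eq_starProjection_of_mem_orthogonal
    (hA _ (G.starProjection_apply_mem x)) ?_
  rw [← map_sub, Submodule.mem_orthogonal]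
  intro g hg
  rw [hAB]
  exact (Submodule.mem_orthogonal _ _).1 (G.sub_starProjection_mem_orthogonal x) _ (hB g hg)

/-- A closed subspace of `H × H` invariant under the diagonal action of a self-adjoint set of
operators is invariant under the diagonal action of its double commutant. -/
theorem Submodule.prodMap_mem_of_mem_centralizer_centralizer {H : Type*} [NormedAddCommGroup H]
    [InnerProductSpace ℂ H] [CompleteSpace H] {𝒮 : Set (H →L[ℂ] H)}
    (hadj : ∀ S ∈ 𝒮, adjoint S ∈ 𝒮) {G : Submodule ℂ (H × H)}
    (hclosed : IsClosed (G : Set (H × H)))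
    (hinv : ∀ S ∈ 𝒮, ∀ g ∈ G, (S g.1, S g.2) ∈ G) {R : H →L[ℂ] H}
    (hR : R ∈ Set.centralizer (Set.centralizer 𝒮)) {g : H × H} (hg : g ∈ G) :
    (R g.1, R g.2) ∈ G := by
  let e := WithLp.prodContinuousLinearEquiv 2 ℂ H H
  let L : Submodule ℂ (WithLp 2 (H × H)) := G.comap (e : WithLp 2 (H × H) →ₗ[ℂ] H × H)
  have hL : IsClosed (L : Set (WithLp 2 (H × H))) := hclosed.preimage e.continuous
  have : CompleteSpace L := hL.completeSpace_coe
  let diag : (H →L[ℂ] H) → (WithLp 2 (H × H) →L[ℂ] WithLp 2 (H × H)) := fun S =>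
    (e.symm : H × H →L[ℂ] WithLp 2 (H × H)) ∘L (S.prodMap S) ∘L
      (e : WithLp 2 (H × H) →L[ℂ] H × H)
  have hP : ∀ S ∈ 𝒮, ∀ x, L.starProjection (diag S x) = diag S (L.starProjection x) := by
    intro S hS
    refine L.starProjection_apply_comm_of_invariant _ (diag (adjoint S)) ?_
      (fun g hg => hinv S hS _ hg) (fun g hg => hinv _ (hadj S hS) _ hg)
    intro x y
    simp [diag, e, WithLp.prod_inner_apply, adjoint_inner_left]
  have hentry : ∀ (a : H × H →L[ℂ] H) (b : H →L[ℂ] H × H),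
      (∀ (S : H →L[ℂ] H) x, a (S.prodMap S x) = S (a x)) →
      (∀ (S : H →L[ℂ] H) x, S.prodMap S (b x) = b (S x)) →
      ∀ x, a (e (L.starProjection (e.symm (b (R x))))) =
        R (a (e (L.starProjection (e.symm (b x))))) := by
    intro a b ha hb
    let C : H →L[ℂ] H := a ∘L (e : WithLp 2 (H × H) →L[ℂ] H × H) ∘L L.starProjection ∘L
      (e.symm : H × H →L[ℂ] WithLp 2 (H × H)) ∘L b
    have hC : C ∈ Set.centralizer 𝒮 := by
      intro S hS
      ext x
      have h := congrArg (fun z => a (e z)) (hP S hS (e.symm (b x)))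
      simp only [diag, ContinuousLinearMap.comp_apply, ContinuousLinearEquiv.coe_coe,
        ContinuousLinearEquiv.apply_symm_apply, ha, hb] at h
      exact h.symm
    exact fun x => congrArg (fun A : H →L[ℂ] H => A x) (hR C hC)
  have hsplit : ∀ x y : H, e.symm (x, y) =
      e.symm (ContinuousLinearMap.inl ℂ H H x) + e.symm (ContinuousLinearMap.inr ℂ H H y) := by
    intro x y
    rw [← map_add]
    simp
  have hcoord : ∀ a : H × H →L[ℂ] H, (∀ (S : H →L[ℂ] H) x, a (S.prodMap S x) = S (a x)) →
      a (e (L.starProjection (e.symm (R g.1, R g.2)))) = R (a g) := by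
    intro a ha
    have hgL : L.starProjection (e.symm (g.1, g.2)) = e.symm (g.1, g.2) :=
      Submodule.starProjection_eq_self_iff.2 (by simpa [L] using hg)
    calc a (e (L.starProjection (e.symm (R g.1, R g.2))))
        = R (a (e (L.starProjection (e.symm (g.1, g.2))))) := by
          rw [hsplit (R g.1), hsplit g.1]
          simp only [map_add]
          rw [hentry a _ ha (by simp), hentry a _ ha (by simp)]
      _ = R (a g) := by rw [hgL, ContinuousLinearEquiv.apply_symm_apply]
  have hmem : e (L.starProjection (e.symm (R g.1, R g.2))) ∈ G :=
    L.starProjection_apply_mem _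
  convert hmem using 1
  exact Prod.ext (hcoord (ContinuousLinearMap.fst ℂ H H) (by simp)).symm
    (hcoord (ContinuousLinearMap.snd ℂ H H) (by simp)).symm

/-- Let `H` be a complex Hilbert space and `𝒮` a set of bounded operators on `H` closed
under taking adjoints.  Let `T` be a densely defined closable unbounded operator on `H`
commuting with `𝒮` (each `S ∈ 𝒮` preserves the domain of `T` and `T(Sv) = S(Tv)` there).
Then the closure of `T` commutes with the double commutant `𝒮''`: every
`R ∈ 𝒮''` preserves the domain of the closure `T̄` and `T̄(Rv) = R(T̄v)` there. -/
theorem stmt19 (H : Type*) [NormedAddCommGroup H] [InnerProductSpace ℂ H]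
    [CompleteSpace H]
    (𝒮 : Set (H →L[ℂ] H)) (hadj : ∀ S ∈ 𝒮, ContinuousLinearMap.adjoint S ∈ 𝒮)
    (T : H →ₗ.[ℂ] H) (hdense : Dense (T.domain : Set H)) (hclosable : T.IsClosable)
    (hcomm : ∀ S ∈ 𝒮, ∀ v : T.domain,
      ∃ h : S (v : H) ∈ T.domain, T ⟨S (v : H), h⟩ = S (T v)) :
    ∀ R ∈ Set.centralizer (Set.centralizer 𝒮), ∀ v : T.closure.domain,
      ∃ h : R (v : H) ∈ T.closure.domain,
        T.closure ⟨R (v : H), h⟩ = R (T.closure v) := by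
  intro R hR v
  have hgraph := hclosable.graph_closure_eq_closure_graph
  have hinv : ∀ S ∈ 𝒮, ∀ g ∈ T.closure.graph, (S g.1, S g.2) ∈ T.closure.graph := by
    intro S hS g hg
    rw [← hgraph] at hg ⊢
    have hmaps : Set.MapsTo (S.prodMap S) (T.graph : Set (H × H)) T.graph := by
      intro x hx
      obtain ⟨w, hw₁, hw₂⟩ := (LinearPMap.mem_graph_iff T).1 hx
      obtain ⟨h, hTS⟩ := hcomm S hS w
      exact (LinearPMap.mem_graph_iff T).2 ⟨⟨S w, h⟩, by simp [hw₁], by simp [hTS, hw₂]⟩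
    exact hmaps.closure (S.prodMap S).continuous hg
  have hmem := Submodule.prodMap_mem_of_mem_centralizer_centralizer hadj
    hclosable.closure_isClosed hinv hR (T.closure.mem_graph v)
  obtain ⟨w, hw₁, hw₂⟩ := (LinearPMap.mem_graph_iff _).1 hmem
  dsimp only at hw₁ hw₂
  have h : R v ∈ T.closure.domain := hw₁ ▸ w.2
  refine ⟨h, ?_⟩
  rw [← hw₂]
  exact congrArg T.closure (Subtype.ext hw₁.symm)
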